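/- arXiv:1608.01570 — 2 statements merged into one kernel-verified Lean document; each statement's English description precedes it below -/
import Mathlib

section
/- Let F_n = F(x₁,…,x_n) with n ≥ 2 and set x_{n+1} := (x₁x₂⋯x_n)⁻¹. Let U ≤ F_n be a proper subgroup generated by finitely many elements, each conjugate in F_n to one of x₁,…,x_n. Then U contains no conjugate of any nontrivial power of x_{n+1}; that is, for all g ∈ F_n and all nonzero integers z, g x_{n+1}^z g⁻¹ ∉ U. -/
open Classical in
/-- The generator `x_j` acts on `X × ℤ`, the integer counts traversals of the edge `(c, i)`. -/
noncomputable def edgePerm {n : ℕ} (U : Subgroup (FreeGroup (Fin n)))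
    (c : FreeGroup (Fin n) ⧸ U) (i j : Fin n) :
    Equiv.Perm ((FreeGroup (Fin n) ⧸ U) × ℤ) where
  toFun p := (FreeGroup.of j • p.1, p.2 + if p.1 = c ∧ j = i then 1 else 0)
  invFun p := ((FreeGroup.of j)⁻¹ • p.1,
    p.2 - if (FreeGroup.of j)⁻¹ • p.1 = c ∧ j = i then 1 else 0)
  left_inv p := by simp
  right_inv p := by simp

/-- The induced action of the free group. -/
noncomputable def edgeAct {n : ℕ} (U : Subgroup (FreeGroup (Fin n)))
    (c : FreeGroup (Fin n) ⧸ U) (i : Fin n) :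
    FreeGroup (Fin n) →* Equiv.Perm ((FreeGroup (Fin n) ⧸ U) × ℤ) :=
  FreeGroup.lift (edgePerm U c i)

theorem edgeAct_of {n : ℕ} (U : Subgroup (FreeGroup (Fin n)))
    (c : FreeGroup (Fin n) ⧸ U) (i j : Fin n) :
    edgeAct U c i (FreeGroup.of j) = edgePerm U c i j := by
  simp [edgeAct]

theorem edgeAct_fst {n : ℕ} (U : Subgroup (FreeGroup (Fin n)))
    (c : FreeGroup (Fin n) ⧸ U) (i : Fin n) (f : FreeGroup (Fin n)) :
    ∀ p, (edgeAct U c i f p).1 = f • p.1 := by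
  induction f using FreeGroup.induction_on with
  | C1 => intro p; simp
  | of j => intro p; rw [edgeAct_of]; rfl
  | inv_of j _ => intro p; rw [map_inv, edgeAct_of]; rfl
  | mul x y hx hy => intro p; rw [map_mul, Equiv.Perm.mul_apply, hx, hy, mul_smul]

theorem edgePerm_loop {n : ℕ} (U : Subgroup (FreeGroup (Fin n)))
    (c : FreeGroup (Fin n) ⧸ U) (i j : Fin n) (hc : FreeGroup.of i • c ≠ c)
    (p : (FreeGroup (Fin n) ⧸ U) × ℤ) (hp : FreeGroup.of j • p.1 = p.1) :
    edgePerm U c i j p = p := by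
  have h : ¬ (p.1 = c ∧ j = i) := by
    rintro ⟨h1, rfl⟩
    exact hc (h1 ▸ hp)
  ext1
  · exact hp
  · simp [edgePerm, h]

theorem edgeAct_list_mono {n : ℕ} (U : Subgroup (FreeGroup (Fin n)))
    (c : FreeGroup (Fin n) ⧸ U) (i : Fin n) (L : List (Fin n)) :
    ∀ p, p.2 ≤ (edgeAct U c i (L.map FreeGroup.of).prod p).2 := by
  induction L with
  | nil => intro p; simp
  | cons j L ih =>
    intro p
    rw [List.map_cons, List.prod_cons, map_mul, Equiv.Perm.mul_apply, edgeAct_of]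
    refine (ih p).trans ?_
    simp only [edgePerm, Equiv.coe_fn_mk]
    split_ifs <;> simp

theorem edgeAct_list_fix {n : ℕ} (U : Subgroup (FreeGroup (Fin n)))
    (y : FreeGroup (Fin n) ⧸ U) (L : List (Fin n)) :
    (∀ c i, FreeGroup.of i • c ≠ c → ∃ m,
      (edgeAct U c i (L.map FreeGroup.of).prod (y, m)).2 = m) →
    ∀ j ∈ L, FreeGroup.of j • y = y := by
  induction L using List.reverseRecOn with
  | nil => simp
  | append_singleton L j ih =>
    intro h
    have hj : FreeGroup.of j • y = y := by
      by_contra hne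
      obtain ⟨m, hm⟩ := h y j hne
      rw [List.map_append, List.prod_append, map_mul, Equiv.Perm.mul_apply] at hm
      simp only [List.map_cons, List.map_nil, List.prod_singleton, edgeAct_of] at hm
      have h1 := edgeAct_list_mono U y j L (edgePerm U y j j (y, m))
      rw [hm] at h1
      simp [edgePerm] at h1
    have h2 := ih (fun c i hc => by
      obtain ⟨m, hm⟩ := h c i hc
      refine ⟨m, ?_⟩
      rw [List.map_append, List.prod_append, map_mul, Equiv.Perm.mul_apply] at hm
      simp only [List.map_cons, List.map_nil, List.prod_singleton, edgeAct_of] at hm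
      rwa [edgePerm_loop U c i j hc (y, m) hj] at hm)
    intro k hk
    rcases List.mem_append.1 hk with hk | hk
    · exact h2 k hk
    · rw [List.mem_singleton.1 hk]; exact hj

theorem edgeAct_gen_fix {n : ℕ} (U : Subgroup (FreeGroup (Fin n)))
    (S : Finset (FreeGroup (Fin n)))
    (hS : ∀ s ∈ S, ∃ (i : Fin n) (g : FreeGroup (Fin n)),
      s = g * FreeGroup.of i * g⁻¹)
    (hU : U = Subgroup.closure (S : Set (FreeGroup (Fin n))))
    (c : FreeGroup (Fin n) ⧸ U) (i : Fin n) (hc : FreeGroup.of i • c ≠ c)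
    (u : FreeGroup (Fin n)) (hu : u ∈ U) :
    edgeAct U c i u (((1 : FreeGroup (Fin n)) : FreeGroup (Fin n) ⧸ U), 0) =
      (((1 : FreeGroup (Fin n)) : FreeGroup (Fin n) ⧸ U), 0) := by
  set b : (FreeGroup (Fin n) ⧸ U) × ℤ :=
    (((1 : FreeGroup (Fin n)) : FreeGroup (Fin n) ⧸ U), 0) with hb
  have key : U ≤ (MulAction.stabilizer (Equiv.Perm ((FreeGroup (Fin n) ⧸ U) × ℤ)) b).comap
      (edgeAct U c i) := by
    conv_lhs => rw [hU]
    rw [Subgroup.closure_le]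
    intro s hs
    obtain ⟨j, g, hg⟩ := hS s hs
    have hsU : s ∈ U := by rw [hU]; exact Subgroup.subset_closure hs
    change edgeAct U c i s b = b
    have hfix : FreeGroup.of j • (edgeAct U c i g⁻¹ b).1 = (edgeAct U c i g⁻¹ b).1 := by
      rw [edgeAct_fst, hb]
      change ((FreeGroup.of j * (g⁻¹ * 1) : FreeGroup (Fin n)) : FreeGroup (Fin n) ⧸ U) =
        ((g⁻¹ * 1 : FreeGroup (Fin n)) : FreeGroup (Fin n) ⧸ U)
      refine (QuotientGroup.eq.2 ?_).symm
      have : (g⁻¹ * 1)⁻¹ * (FreeGroup.of j * (g⁻¹ * 1)) = s := by rw [hg]; group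
      rw [this]; exact hsU
    rw [hg, map_mul, map_mul, Equiv.Perm.mul_apply, Equiv.Perm.mul_apply, edgeAct_of,
      edgePerm_loop U c i j hc _ hfix, ← Equiv.Perm.mul_apply, ← map_mul]
    simp
  exact key hu

/-- A proper subgroup of `F_n` (n ≥ 2) generated by finitely many conjugates of
the basis elements contains no conjugate of a nontrivial power of
`x_{n+1} = (x₁ ⋯ x_n)⁻¹`. -/
theorem stmt_12 (n : ℕ) (hn : 2 ≤ n) (U : Subgroup (FreeGroup (Fin n)))
    (S : Finset (FreeGroup (Fin n)))
    (hS : ∀ s ∈ S, ∃ (i : Fin n) (g : FreeGroup (Fin n)),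
      s = g * FreeGroup.of i * g⁻¹)
    (hU : U = Subgroup.closure (S : Set (FreeGroup (Fin n))))
    (hproper : U ≠ ⊤) :
    ∀ (g : FreeGroup (Fin n)) (z : ℤ), z ≠ 0 →
      g * ((List.ofFn fun i : Fin n =>
        (FreeGroup.of i : FreeGroup (Fin n))).prod)⁻¹ ^ z * g⁻¹ ∉ U := by
  intro g z hz hmem
  set w := (List.ofFn fun i : Fin n => (FreeGroup.of i : FreeGroup (Fin n))).prod with hw
  have hk : g * w ^ z.natAbs * g⁻¹ ∈ U := by
    rcases Int.natAbs_eq z with h | h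
    · have h2 := U.inv_mem hmem
      have e : (g * w⁻¹ ^ z * g⁻¹)⁻¹ = g * w ^ z.natAbs * g⁻¹ := by
        rw [← zpow_natCast, ← h]; group
      rwa [e] at h2
    · have e : g * w⁻¹ ^ z * g⁻¹ = g * w ^ z.natAbs * g⁻¹ := by
        rw [← zpow_natCast, inv_zpow', show (z.natAbs : ℤ) = -z by omega]
      rwa [e] at hmem
  have hk0 : z.natAbs ≠ 0 := by omega
  generalize z.natAbs = k at hk hk0
  let L : List (Fin n) := (List.replicate k (List.finRange n)).flatten
  have hL : (L.map FreeGroup.of).prod = w ^ k := by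
    simp only [L, List.map_flatten, List.map_replicate, List.prod_flatten, List.prod_replicate,
      hw, List.ofFn_eq_map]
  have hall : ∀ j : Fin n, FreeGroup.of j • ((g⁻¹ : FreeGroup (Fin n)) : FreeGroup (Fin n) ⧸ U) =
      ((g⁻¹ : FreeGroup (Fin n)) : FreeGroup (Fin n) ⧸ U) := by
    intro j
    refine edgeAct_list_fix U _ L ?_ j ?_
    · intro c i hc
      have h1 := edgeAct_gen_fix U S hS hU c i hc _ hk
      set b : (FreeGroup (Fin n) ⧸ U) × ℤ :=
        (((1 : FreeGroup (Fin n)) : FreeGroup (Fin n) ⧸ U), 0) with hb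
      have h2 : edgeAct U c i (w ^ k) (edgeAct U c i g⁻¹ b) = edgeAct U c i g⁻¹ b := by
        rw [map_mul, map_mul, Equiv.Perm.mul_apply, Equiv.Perm.mul_apply] at h1
        rw [map_inv, Equiv.Perm.eq_inv_iff_eq, ← map_inv]
        exact h1
      have h3 : edgeAct U c i g⁻¹ b =
          (((g⁻¹ : FreeGroup (Fin n)) : FreeGroup (Fin n) ⧸ U), (edgeAct U c i g⁻¹ b).2) := by
        ext1
        · rw [edgeAct_fst, hb]
          change ((g⁻¹ * 1 : FreeGroup (Fin n)) : FreeGroup (Fin n) ⧸ U) = _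
          rw [mul_one]
        · rfl
      refine ⟨(edgeAct U c i g⁻¹ b).2, ?_⟩
      rw [hL, ← h3, h2]
    · simp only [L, List.mem_flatten, List.mem_replicate]
      exact ⟨_, ⟨hk0, rfl⟩, List.mem_finRange j⟩
  have hst : MulAction.stabilizer (FreeGroup (Fin n))
      ((g⁻¹ : FreeGroup (Fin n)) : FreeGroup (Fin n) ⧸ U) = ⊤ := by
    rw [eq_top_iff, ← FreeGroup.closure_range_of, Subgroup.closure_le]
    rintro _ ⟨j, rfl⟩
    exact hall j
  apply hproper
  rw [eq_top_iff]
  intro u _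
  have hu : g⁻¹ * u * g ∈ MulAction.stabilizer (FreeGroup (Fin n))
      ((g⁻¹ : FreeGroup (Fin n)) : FreeGroup (Fin n) ⧸ U) := by rw [hst]; trivial
  have h4 : ((g⁻¹ * u * g * g⁻¹ : FreeGroup (Fin n)) : FreeGroup (Fin n) ⧸ U) =
    ((g⁻¹ : FreeGroup (Fin n)) : FreeGroup (Fin n) ⧸ U) := hu
  have h5 := QuotientGroup.eq.1 h4.symm
  have e : (g⁻¹)⁻¹ * (g⁻¹ * u * g * g⁻¹) = u := by group
  rwa [e] at h5
end

section
/- Let F_n = F(x₁,…,x_n) with n ≥ 2 and let B = F_n × ℤ = ⟨x₁,…,x_n, t | [xᵢ,t] = 1⟩. For i ∈ {1,…,n} let C_i = ⟨x_i, t⟩ ≤ B. Let U = ⟨S⟩ × ⟨t⟩ where S is a finite set of conjugates of basis elements x_{j} (j ∈ {1,…,n}), and suppose U ≠ B. Then for every g ∈ B and every i, either g C_i g⁻¹ ∩ U = ⟨t⟩, or g x_i g⁻¹ ∈ U (in which case g C_i g⁻¹ ≤ U). -/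
namespace Stmt17

open Classical in
/-- Permutation of `F/H × ℤ` covering the action of `x_j`, counting passages through one edge. -/
noncomputable def step {n : ℕ} (H : Subgroup (FreeGroup (Fin n))) (i : Fin n)
    (v : FreeGroup (Fin n) ⧸ H) (j : Fin n) :
    Equiv.Perm ((FreeGroup (Fin n) ⧸ H) × ℤ) where
  toFun p := (FreeGroup.of j • p.1, p.2 + if j = i ∧ p.1 = v then 1 else 0)
  invFun p := ((FreeGroup.of j)⁻¹ • p.1,
    p.2 - if j = i ∧ (FreeGroup.of j)⁻¹ • p.1 = v then 1 else 0)
  left_inv p := by simp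
  right_inv p := by simp

/-- The action of the free group on `F/H × ℤ`. -/
noncomputable def act {n : ℕ} (H : Subgroup (FreeGroup (Fin n))) (i : Fin n)
    (v : FreeGroup (Fin n) ⧸ H) :
    FreeGroup (Fin n) →* Equiv.Perm ((FreeGroup (Fin n) ⧸ H) × ℤ) :=
  FreeGroup.lift (step H i v)

theorem act_fst {n : ℕ} (H : Subgroup (FreeGroup (Fin n))) (i : Fin n)
    (v : FreeGroup (Fin n) ⧸ H) (g : FreeGroup (Fin n)) :
    ∀ p, (act H i v g p).1 = g • p.1 := by
  induction g using FreeGroup.induction_on with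
  | C1 => intro p; simp
  | of j => intro p; simp [act, step]
  | inv_of j _ =>
    intro p
    rw [map_inv]
    simp only [act, FreeGroup.lift_apply_of]
    rfl
  | mul a b ha hb => intro p; rw [map_mul, Equiv.Perm.mul_apply, ha, hb, mul_smul]

theorem act_pow_snd {n : ℕ} (H : Subgroup (FreeGroup (Fin n))) (i : Fin n)
    (v : FreeGroup (Fin n) ⧸ H) (m : ℤ) (k : ℕ) :
    m + 1 ≤ (act H i v (FreeGroup.of i ^ (k + 1)) (v, m)).2 := by
  induction k with
  | zero => simp [act, step]
  | succ k ih =>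
    rw [pow_succ', map_mul, Equiv.Perm.mul_apply]
    refine ih.trans ?_
    generalize (act H i v (FreeGroup.of i ^ (k + 1)) (v, m)) = p
    simp only [act, FreeGroup.lift_apply_of, step, Equiv.coe_fn_mk]
    split_ifs <;> omega

theorem key_nat {n : ℕ} (S : Set (FreeGroup (Fin n)))
    (hS : ∀ s ∈ S, ∃ (j : Fin n) (w : FreeGroup (Fin n)), s = w * FreeGroup.of j * w⁻¹)
    (w : FreeGroup (Fin n)) (i : Fin n) (k : ℕ)
    (h : w * FreeGroup.of i ^ (k + 1) * w⁻¹ ∈ Subgroup.closure S) :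
    w * FreeGroup.of i * w⁻¹ ∈ Subgroup.closure S := by
  by_contra hx
  set H := Subgroup.closure S with hH
  let b : FreeGroup (Fin n) ⧸ H := ((1 : FreeGroup (Fin n)) : FreeGroup (Fin n) ⧸ H)
  have hb : ∀ g : FreeGroup (Fin n), g • b = b ↔ g ∈ H := by
    intro g
    rw [← MulAction.mem_stabilizer_iff, MulAction.stabilizer_quotient]
  have hconj : ∀ u y : FreeGroup (Fin n), u * y * u⁻¹ ∈ H ↔ y • (u⁻¹ • b) = u⁻¹ • b := by
    intro u y
    rw [← hb, mul_smul, mul_smul, smul_eq_iff_eq_inv_smul]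
  let v := w⁻¹ • b
  have hv : FreeGroup.of i • v ≠ v := fun e => hx ((hconj _ _).2 e)
  have hstab : H ≤ (MulAction.stabilizer (Equiv.Perm ((FreeGroup (Fin n) ⧸ H) × ℤ))
      ((b, 0) : (FreeGroup (Fin n) ⧸ H) × ℤ)).comap (act H i v) := by
    refine (Subgroup.closure_le _).2 ?_
    intro s hs
    have hsH : s ∈ H := Subgroup.subset_closure hs
    obtain ⟨j, u, rfl⟩ := hS s hs
    rw [hconj] at hsH
    simp only [SetLike.mem_coe, Subgroup.mem_comap, MulAction.mem_stabilizer_iff,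
      Equiv.Perm.smul_def, map_mul, Equiv.Perm.mul_apply]
    have h1 := act_fst H i v u⁻¹ (b, 0)
    have h2 : act H i v (FreeGroup.of j) (act H i v u⁻¹ (b, 0)) = act H i v u⁻¹ (b, 0) := by
      generalize act H i v u⁻¹ (b, 0) = p at h1 ⊢
      obtain ⟨q, m⟩ := p
      simp only at h1
      rw [← h1] at hsH
      simp only [act, FreeGroup.lift_apply_of, step, Equiv.coe_fn_mk, hsH]
      rw [if_neg]
      · simp
      · rintro ⟨rfl, rfl⟩
        exact hv hsH
    rw [h2, ← Equiv.Perm.mul_apply, ← map_mul, mul_inv_cancel, map_one, Equiv.Perm.one_apply]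
  have h3 := hstab h
  simp only [Subgroup.mem_comap, MulAction.mem_stabilizer_iff,
      Equiv.Perm.smul_def, map_mul, Equiv.Perm.mul_apply] at h3
  rw [← Equiv.Perm.eq_inv_iff_eq, ← map_inv] at h3
  have h1 := act_fst H i v w⁻¹ (b, 0)
  generalize act H i v w⁻¹ (b, 0) = p at h1 h3
  obtain ⟨q, m⟩ := p
  obtain rfl : q = v := h1
  have := act_pow_snd H i v m k
  rw [h3] at this
  simp at this

theorem key {n : ℕ} (S : Set (FreeGroup (Fin n)))
    (hS : ∀ s ∈ S, ∃ (j : Fin n) (w : FreeGroup (Fin n)), s = w * FreeGroup.of j * w⁻¹)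
    (w : FreeGroup (Fin n)) (i : Fin n) (k : ℤ) (hk : k ≠ 0)
    (h : w * FreeGroup.of i ^ k * w⁻¹ ∈ Subgroup.closure S) :
    w * FreeGroup.of i * w⁻¹ ∈ Subgroup.closure S := by
  obtain ⟨m, rfl | rfl⟩ := k.eq_nat_or_neg
  · obtain ⟨m, rfl⟩ := Nat.exists_eq_succ_of_ne_zero (n := m) (by simpa using hk)
    exact key_nat S hS w i m (by simpa only [zpow_natCast] using h)
  · obtain ⟨m, rfl⟩ := Nat.exists_eq_succ_of_ne_zero (n := m) (by simpa using hk)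
    refine key_nat S hS w i m ?_
    have := inv_mem h
    rw [zpow_neg, zpow_natCast] at this
    simpa [mul_assoc] using this

end Stmt17

/-- In `B = F_n × ℤ` (the composing space group), let `Cᵢ = ⟨xᵢ, t⟩` and let
`U = ⟨S⟩ × ⟨t⟩` where `S` consists of conjugates of basis elements. If `U ≠ B`,
then for all `g ∈ B` and all `i`, either `g Cᵢ g⁻¹ ∩ U = ⟨t⟩`, or
`g xᵢ g⁻¹ ∈ U` and `g Cᵢ g⁻¹ ≤ U`. -/
theorem stmt_17 (n : ℕ) (hn : 2 ≤ n)
    (S : Finset (FreeGroup (Fin n)))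
    (hS : ∀ s ∈ S, ∃ (j : Fin n) (w : FreeGroup (Fin n)),
      s = w * FreeGroup.of j * w⁻¹)
    (U : Subgroup (FreeGroup (Fin n) × Multiplicative ℤ))
    (hU : U = (Subgroup.closure (S : Set (FreeGroup (Fin n)))).prod
      (⊤ : Subgroup (Multiplicative ℤ)))
    (hproper : U ≠ ⊤) :
    ∀ (g : FreeGroup (Fin n) × Multiplicative ℤ) (i : Fin n),
      (Subgroup.map (MulAut.conj g).toMonoidHom
          (Subgroup.closure {(FreeGroup.of i, (1 : Multiplicative ℤ)),
            ((1 : FreeGroup (Fin n)), Multiplicative.ofAdd 1)}) ⊓ U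
        = Subgroup.closure
            {((1 : FreeGroup (Fin n)), Multiplicative.ofAdd (1 : ℤ))}) ∨
      (g * (FreeGroup.of i, (1 : Multiplicative ℤ)) * g⁻¹ ∈ U ∧
        Subgroup.map (MulAut.conj g).toMonoidHom
          (Subgroup.closure {(FreeGroup.of i, (1 : Multiplicative ℤ)),
            ((1 : FreeGroup (Fin n)), Multiplicative.ofAdd 1)}) ≤ U) := by
  subst hU
  intro g i
  by_cases hx : g.1 * FreeGroup.of i * g.1⁻¹ ∈ Subgroup.closure (S : Set (FreeGroup (Fin n)))
  · right
    refine ⟨by simpa [Subgroup.mem_prod] using hx, ?_⟩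
    rw [Subgroup.map_le_iff_le_comap, Subgroup.closure_le]
    rintro y (rfl | rfl)
    · simpa [Subgroup.mem_prod] using hx
    · simp [Subgroup.mem_prod]
  · left
    apply le_antisymm
    · rintro y ⟨⟨c, hc, rfl⟩, hy⟩
      have hc1 : c.1 ∈ Subgroup.zpowers (FreeGroup.of i) := by
        have hle : Subgroup.closure {(FreeGroup.of i, (1 : Multiplicative ℤ)),
            ((1 : FreeGroup (Fin n)), Multiplicative.ofAdd 1)} ≤
            (Subgroup.zpowers (FreeGroup.of i)).comap (MonoidHom.fst _ _) := by
          rw [Subgroup.closure_le]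
          rintro y (rfl | rfl)
          · simp
          · simp
        exact hle hc
      obtain ⟨k, hk⟩ := Subgroup.mem_zpowers_iff.1 hc1
      have hy1 := (Subgroup.mem_prod.1 hy).1
      have hk0 : k = 0 := by
        by_contra hne
        exact hx (Stmt17.key _ hS g.1 i k hne (by rw [hk]; simpa using hy1))
      rw [hk0, zpow_zero] at hk
      rw [← Subgroup.zpowers_eq_closure, Subgroup.mem_zpowers_iff]
      refine ⟨Multiplicative.toAdd c.2, ?_⟩
      apply Prod.ext
      · simp [← hk]
      · simp [← ofAdd_zsmul]
    · rw [Subgroup.closure_le]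
      rintro y rfl
      refine ⟨⟨_, Subgroup.subset_closure (Or.inr rfl), ?_⟩, ?_⟩
      · apply Prod.ext <;> simp
      · simp [Subgroup.mem_prod]
end
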